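/- Fix an integer n ≥ 2, x₀ > 0 and c ∈ [0,1). Let λ(c) = (1 - n·c + (n-1)·c^{n/(n-1)})/n, x̄(c) = (1-c)·x₀/λ(c), and let F̃_c be the driftless equilibrium cdf: F̃_c(x) = (c + λ(c)·x/x₀)^{1/(n-1)} for x ∈ [0, x̄(c)], F̃_c(x) = 1 for x ≥ x̄(c). Then: (i) for every Borel probability measure ν on [0,∞) with ∫ x dν(x) = x₀, we have ∫ max(F̃_c(x)^{n-1} - c, 0) dν(x) ≤ λ(c); and (ii) if ν is the probability measure whose cdf is F̃_c, then ∫ max(F̃_c(x)^{n-1} - c, 0) dν(x) = λ(c). Hence F̃_c is a best response to itself in the static contest in which each agent chooses a mean-x₀ distribution over stopped values, which is the equilibrium property underlying the paper's Proposition 1 in the driftless case. -/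

import Mathlib

open MeasureTheory

/-- The slope coefficient `λ(c) = (1 - n·c + (n-1)·c^{n/(n-1)})/n` of the equilibrium
winning probability in the `n`-player risk-taking contest with submission fee `c`. -/
noncomputable def lamFee (n : ℕ) (c : ℝ) : ℝ :=
  (1 - n * c + ((n : ℝ) - 1) * c ^ ((n : ℝ) / ((n : ℝ) - 1))) / n

/-- Upper bound of the support of the driftless equilibrium distribution:
`x̄(c) = (1-c)·x₀/λ(c)`. -/
noncomputable def tildeXbar (n : ℕ) (x₀ c : ℝ) : ℝ :=
  (1 - c) * x₀ / lamFee n c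

/-- The driftless equilibrium cdf: `F̃_c(x) = (c + λ(c)·x/x₀)^{1/(n-1)}` on `[0, x̄(c)]`,
equal to `1` above `x̄(c)` and `0` below `0`. -/
noncomputable def tildeF (n : ℕ) (x₀ c x : ℝ) : ℝ :=
  if x < 0 then 0
  else if x ≤ tildeXbar n x₀ c then (c + lamFee n c * x / x₀) ^ ((1 : ℝ) / ((n : ℝ) - 1))
  else 1

theorem one_sub_add_pow_pos {b : ℝ} (h0 : 0 ≤ b) (h1 : b < 1) (m : ℕ) :
    0 < 1 - ((m : ℝ) + 2) * b ^ (m + 1) + ((m : ℝ) + 1) * b ^ (m + 2) := by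
  induction m with
  | zero =>
    norm_num
    nlinarith [mul_pos (sub_pos.2 h1) (sub_pos.2 h1)]
  | succ m ih =>
    have h : 0 ≤ ((m : ℝ) + 2) * b ^ (m + 1) * (1 - b) ^ 2 := by positivity
    push_cast
    calc _ < _ := ih
      _ ≤ _ := by linear_combination h

theorem lamFee_pos {n : ℕ} (hn : 2 ≤ n) {c : ℝ} (hc : c ∈ Set.Ico (0 : ℝ) 1) :
    0 < lamFee n c := by
  obtain ⟨m, rfl⟩ := Nat.exists_eq_add_of_le' hn
  have hb0 : 0 ≤ c ^ ((1 : ℝ) / ((m : ℝ) + 1)) := Real.rpow_nonneg hc.1 _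
  have hb1 : c ^ ((1 : ℝ) / ((m : ℝ) + 1)) < 1 := Real.rpow_lt_one hc.1 hc.2 (by positivity)
  have key := one_sub_add_pow_pos hb0 hb1 m
  rw [← Real.rpow_natCast, ← Real.rpow_natCast, ← Real.rpow_mul hc.1, ← Real.rpow_mul hc.1] at key
  have hpred : (m : ℝ) + 2 - 1 = m + 1 := by ring
  have hexp_pred : (1 : ℝ) / ((m : ℝ) + 1) * ((m + 1 : ℕ) : ℝ) = 1 := by push_cast; field_simp
  have hexp : (1 : ℝ) / ((m : ℝ) + 1) * ((m + 2 : ℕ) : ℝ) =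
      ((m + 2 : ℕ) : ℝ) / (((m + 2 : ℕ) : ℝ) - 1) := by
    push_cast
    rw [hpred]
    ring
  rw [hexp_pred, hexp, Real.rpow_one] at key
  unfold lamFee
  refine div_pos ?_ (by positivity)
  push_cast at key ⊢
  rwa [hpred] at key ⊢

theorem le_tildeXbar_iff {n : ℕ} {x₀ c x : ℝ} (hx₀ : 0 < x₀) (hl : 0 < lamFee n c) :
    x ≤ tildeXbar n x₀ c ↔ lamFee n c * x / x₀ ≤ 1 - c := by
  unfold tildeXbar
  rw [le_div_iff₀ hl, div_le_iff₀ hx₀, mul_comm x]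

/-- The payoff against `F̃_c` is the slope-`λ(c)/x₀` ray truncated to `[0, 1 - c]`. -/
theorem tildeF_payoff_eq {n : ℕ} (hn : 2 ≤ n) {x₀ c : ℝ} (hx₀ : 0 < x₀)
    (hc : c ∈ Set.Ico (0 : ℝ) 1) (x : ℝ) :
    max (tildeF n x₀ c x ^ (n - 1) - c) 0 = max (min (lamFee n c * x / x₀) (1 - c)) 0 := by
  have hl := lamFee_pos hn hc
  have hn1 : n - 1 ≠ 0 := by omega
  have hcast : (n : ℝ) - 1 = ((n - 1 : ℕ) : ℝ) := by
    rw [Nat.cast_sub (by omega), Nat.cast_one]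
  unfold tildeF
  split_ifs with h1 h2
  · have h : lamFee n c * x / x₀ ≤ 0 :=
      div_nonpos_of_nonpos_of_nonneg (mul_nonpos_of_nonneg_of_nonpos hl.le h1.le) hx₀.le
    rw [zero_pow hn1, max_eq_right (by linarith [hc.1]),
      max_eq_right ((min_le_left _ _).trans h)]
  · have hx : 0 ≤ x := not_lt.1 h1
    have h : 0 ≤ c + lamFee n c * x / x₀ := add_nonneg hc.1 (by positivity)
    rw [min_eq_left ((le_tildeXbar_iff hx₀ hl).1 h2), hcast, one_div,
      Real.rpow_inv_natCast_pow h hn1, add_sub_cancel_left]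
  · rw [le_tildeXbar_iff hx₀ hl, not_le] at h2
    rw [min_eq_right h2.le, one_pow]

theorem integral_tildeF_payoff_le {n : ℕ} (hn : 2 ≤ n) {x₀ c : ℝ} (hx₀ : 0 < x₀)
    (hc : c ∈ Set.Ico (0 : ℝ) 1) {ν : Measure ℝ} (hν : ν (Set.Iio 0) = 0)
    (hmean : ∫ x, x ∂ν = x₀) :
    ∫ x, max (tildeF n x₀ c x ^ (n - 1) - c) 0 ∂ν ≤ lamFee n c := by
  have hl := lamFee_pos hn hc
  have hint : Integrable (fun x : ℝ => x) ν :=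
    Integrable.of_integral_ne_zero (by rw [hmean]; exact hx₀.ne')
  have hnonneg : ∀ᵐ x ∂ν, 0 ≤ x := by
    simp only [ae_iff, not_le]
    exact hν
  calc ∫ x, max (tildeF n x₀ c x ^ (n - 1) - c) 0 ∂ν
      ≤ ∫ x, lamFee n c / x₀ * x ∂ν := by
        refine integral_mono_of_nonneg (ae_of_all _ fun x => le_max_right _ _)
          (hint.const_mul _) ?_
        filter_upwards [hnonneg] with x hx
        rw [tildeF_payoff_eq hn hx₀ hc, div_mul_eq_mul_div]
        exact max_le (min_le_left _ _) (by positivity)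
    _ = lamFee n c := by
        rw [integral_const_mul, hmean, div_mul_cancel₀ _ hx₀.ne']

theorem measureReal_lt_truncated_ray {n : ℕ} (hn : 2 ≤ n) {x₀ c : ℝ} (hx₀ : 0 < x₀)
    (hc : c ∈ Set.Ico (0 : ℝ) 1) {ν : Measure ℝ} [IsProbabilityMeasure ν]
    (hν : ∀ x : ℝ, ν (Set.Iic x) = ENNReal.ofReal (tildeF n x₀ c x)) {t : ℝ} (ht : 0 < t) :
    ν.real {x | t < max (min (lamFee n c * x / x₀) (1 - c)) 0} =
      (Set.Ioo 0 (1 - c)).indicator (fun s => 1 - (c + s) ^ ((1 : ℝ) / ((n : ℝ) - 1))) t := by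
  have hl := lamFee_pos hn hc
  by_cases htc : t < 1 - c
  · have hset : {x | t < max (min (lamFee n c * x / x₀) (1 - c)) 0} =
        (Set.Iic (t * x₀ / lamFee n c))ᶜ := by
      ext x
      simp [htc, ht.not_gt, lt_div_iff₀ hx₀, div_lt_iff₀ hl, mul_comm]
    have hq : lamFee n c * (t * x₀ / lamFee n c) / x₀ = t := by field_simp
    have hF : tildeF n x₀ c (t * x₀ / lamFee n c) = (c + t) ^ ((1 : ℝ) / ((n : ℝ) - 1)) := by
      unfold tildeF
      rw [if_neg (not_lt.2 (by positivity)), if_pos ((le_tildeXbar_iff hx₀ hl).2 (by linarith)), hq]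
    rw [Set.indicator_of_mem (Set.mem_Ioo.2 ⟨ht, htc⟩), hset, probReal_compl_eq_one_sub measurableSet_Iic,
      measureReal_def, hν, hF,
      ENNReal.toReal_ofReal (Real.rpow_nonneg (by linarith [hc.1]) _)]
  · rw [Set.indicator_of_notMem (fun h => htc h.2)]
    have hset : {x | t < max (min (lamFee n c * x / x₀) (1 - c)) 0} = ∅ := by
      ext x
      simp [htc, ht.not_gt]
    rw [hset, measureReal_empty]

theorem integral_one_sub_rpow_eq_lamFee {n : ℕ} (hn : 2 ≤ n) (c : ℝ) :
    ∫ t in (0 : ℝ)..(1 - c), (1 - (c + t) ^ ((1 : ℝ) / ((n : ℝ) - 1))) = lamFee n c := by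
  have hn2 : (2 : ℝ) ≤ n := by exact_mod_cast hn
  have hm : (0 : ℝ) < (n : ℝ) - 1 := by linarith
  have hr : (0 : ℝ) ≤ 1 / ((n : ℝ) - 1) := by positivity
  have hexp : (1 : ℝ) / ((n : ℝ) - 1) + 1 = (n : ℝ) / ((n : ℝ) - 1) := by field_simp; ring
  have hcont : Continuous fun t : ℝ => t ^ ((1 : ℝ) / ((n : ℝ) - 1)) :=
    Real.continuous_rpow_const hr
  rw [intervalIntegral.integral_comp_add_left (fun u => 1 - u ^ ((1 : ℝ) / ((n : ℝ) - 1))) c,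
    intervalIntegral.integral_sub (by simp) (hcont.intervalIntegrable _ _),
    integral_rpow (Or.inl (by linarith)), hexp]
  simp only [add_zero, add_sub_cancel, intervalIntegral.integral_const, smul_eq_mul, mul_one,
    Real.one_rpow]
  unfold lamFee
  field_simp
  ring

theorem integral_tildeF_payoff_eq {n : ℕ} (hn : 2 ≤ n) {x₀ c : ℝ} (hx₀ : 0 < x₀)
    (hc : c ∈ Set.Ico (0 : ℝ) 1) {ν : Measure ℝ} [IsProbabilityMeasure ν]
    (hν : ∀ x : ℝ, ν (Set.Iic x) = ENNReal.ofReal (tildeF n x₀ c x)) :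
    ∫ x, max (tildeF n x₀ c x ^ (n - 1) - c) 0 ∂ν = lamFee n c := by
  have hc1 : 0 ≤ 1 - c := sub_nonneg.2 hc.2.le
  simp_rw [tildeF_payoff_eq hn hx₀ hc]
  have hint : Integrable (fun x => max (min (lamFee n c * x / x₀) (1 - c)) 0) ν := by
    refine Integrable.of_bound (Continuous.aestronglyMeasurable (by fun_prop)) (1 - c)
      (ae_of_all _ fun x => ?_)
    rw [Real.norm_of_nonneg (le_max_right _ _)]
    exact max_le (min_le_right _ _) hc1
  rw [hint.integral_eq_integral_meas_lt (ae_of_all _ fun x => le_max_right _ _),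
    setIntegral_congr_fun measurableSet_Ioi fun t ht =>
      measureReal_lt_truncated_ray hn hx₀ hc hν ht,
    setIntegral_indicator measurableSet_Ioo, Set.inter_eq_right.2 Set.Ioo_subset_Ioi_self,
    ← integral_Ioc_eq_integral_Ioo, ← intervalIntegral.integral_of_le hc1,
    integral_one_sub_rpow_eq_lamFee hn]

/-- `F̃_c` is a best response to itself in the static contest where each agent chooses a
mean-`x₀` distribution over stopped values: (i) every feasible (mean-`x₀`, supported on
`[0,∞)`) distribution yields payoff at most `λ(c)` against `n-1` opponents playing `F̃_c`;
(ii) the distribution with cdf `F̃_c` itself attains exactly `λ(c)`. -/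
theorem tildeF_best_response (n : ℕ) (hn : 2 ≤ n) (x₀ c : ℝ) (hx₀ : 0 < x₀)
    (hc : c ∈ Set.Ico (0 : ℝ) 1) :
    (∀ ν : Measure ℝ, IsProbabilityMeasure ν → ν (Set.Iio 0) = 0 →
      (∫ x, x ∂ν) = x₀ →
      (∫ x, max ((tildeF n x₀ c x) ^ (n - 1) - c) 0 ∂ν) ≤ lamFee n c) ∧
    (∀ ν : Measure ℝ, IsProbabilityMeasure ν →
      (∀ x : ℝ, ν (Set.Iic x) = ENNReal.ofReal (tildeF n x₀ c x)) →
      (∫ x, max ((tildeF n x₀ c x) ^ (n - 1) - c) 0 ∂ν) = lamFee n c) := by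
  exact ⟨fun _ _ hν hmean => integral_tildeF_payoff_le hn hx₀ hc hν hmean,
    fun _ _ hν => integral_tildeF_payoff_eq hn hx₀ hc hν⟩
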